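/- Let Π be a nonempty finite set, m and K positive integers with K ≤ |Π|, and let V, V̂ : Π → [0,1]^m with coordinates V_i(π), V̂_i(π). Assume |V_i(π) − V̂_i(π)| ≤ c_i(π) for all i ∈ {1,…,m} and π ∈ Π, where c_i(π) ≥ 0, and define c(S) = Σ_{π ∈ S} Σ_{i=1}^m c_i(π) for S ⊆ Π. Define the lower confidence bound L_i(π) = V̂_i(π) − c_i(π) and assume L_i(π) ∈ [0,1] for all i and π. Let S* be a subset of Π of size K maximizing vol(S, V) over all subsets S ⊆ Π of size K. Let α ∈ [0,1] and let Ŝ ⊆ Π of size K satisfy vol(Ŝ, L) ≥ α · max_{S ⊆ Π, |S| = K} vol(S, L). Then vol(Ŝ, V) ≥ α · vol(S*, V) − 2 c(S*). -/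

import Mathlib

open MeasureTheory

/-- The hypervolume indicator of a finite set `S` of policies under value function `V`:
the Lebesgue measure of `⋃ π ∈ S, ∏_{i} [0, V π i]`. -/
noncomputable def vol {P : Type*} {m : ℕ} (S : Finset P) (V : P → Fin m → ℝ) : ℝ :=
  (volume (⋃ π ∈ S, Set.Icc (0 : Fin m → ℝ) (V π))).toReal

/-- The part of the box `[0, v]` outside `[0, l]` is covered by one slab of thickness `v i - l i`
for each coordinate `i`. -/
lemma volume_Icc_diff_Icc_le {ι : Type*} [Fintype ι] {l v : ι → ℝ}
    (hlv : l ≤ v) (hv : ∀ i, v i ≤ 1) :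
    volume (Set.Icc 0 v \ Set.Icc 0 l) ≤ ENNReal.ofReal (∑ i, (v i - l i)) := by
  classical
  have hsub : Set.Icc 0 v \ Set.Icc 0 l ⊆
      ⋃ i ∈ Finset.univ, Set.univ.pi (fun j => if j = i then Set.Icc (l i) (v i)
        else Set.Icc (0 : ℝ) 1) := by
    rintro x ⟨⟨hx0, hxv⟩, hx⟩
    obtain ⟨i, hi⟩ : ∃ i, l i < x i := by
      by_contra! h
      exact hx ⟨hx0, h⟩
    simp only [Set.mem_iUnion]
    refine ⟨i, Finset.mem_univ i, fun j _ => ?_⟩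
    dsimp only
    split_ifs with hj
    · subst hj
      exact ⟨hi.le, hxv j⟩
    · exact ⟨hx0 j, (hxv j).trans (hv j)⟩
  refine (measure_mono hsub).trans ((measure_biUnion_finset_le _ _).trans ?_)
  rw [ENNReal.ofReal_sum_of_nonneg fun i _ => sub_nonneg.2 (hlv i)]
  refine Finset.sum_le_sum fun i _ => le_of_eq ?_
  rw [volume_pi_pi, Finset.prod_eq_single i]
  · simp
  · intro j _ hj
    simp [hj]
  · simp

lemma volume_biUnion_Icc_lt_top {P : Type*} {m : ℕ} (S : Finset P) (V : P → Fin m → ℝ) :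
    volume (⋃ π ∈ S, Set.Icc (0 : Fin m → ℝ) (V π)) < ⊤ :=
  measure_biUnion_lt_top S.finite_toSet fun _ _ => isCompact_Icc.measure_lt_top

lemma vol_mono {P : Type*} {m : ℕ} (S : Finset P) {L V : P → Fin m → ℝ} (h : L ≤ V) :
    vol S L ≤ vol S V :=
  ENNReal.toReal_mono (volume_biUnion_Icc_lt_top S V).ne
    (measure_mono (Set.iUnion₂_mono fun π _ => Set.Icc_subset_Icc_right (h π)))

lemma vol_le_vol_add_sum {P : Type*} {m : ℕ} (S : Finset P) {L V : P → Fin m → ℝ}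
    (h : L ≤ V) (hV : ∀ π i, V π i ≤ 1) :
    vol S V ≤ vol S L + ∑ π ∈ S, ∑ i, (V π i - L π i) := by
  have hnonneg : ∀ π ∈ S, 0 ≤ ∑ i, (V π i - L π i) := fun π _ =>
    Finset.sum_nonneg fun i _ => sub_nonneg.2 (h π i)
  have hsub : (⋃ π ∈ S, Set.Icc (0 : Fin m → ℝ) (V π)) ⊆
      (⋃ π ∈ S, Set.Icc 0 (L π)) ∪ ⋃ π ∈ S, (Set.Icc 0 (V π) \ Set.Icc 0 (L π)) := by
    intro x hx
    simp only [Set.mem_union, Set.mem_iUnion, Set.mem_sdiff] at hx ⊢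
    obtain ⟨π, hπ, hxπ⟩ := hx
    by_cases hxL : x ∈ Set.Icc 0 (L π)
    · exact .inl ⟨π, hπ, hxL⟩
    · exact .inr ⟨π, hπ, hxπ, hxL⟩
  have hle : volume (⋃ π ∈ S, Set.Icc (0 : Fin m → ℝ) (V π)) ≤
      volume (⋃ π ∈ S, Set.Icc (0 : Fin m → ℝ) (L π)) +
        ENNReal.ofReal (∑ π ∈ S, ∑ i, (V π i - L π i)) := by
    refine (measure_mono hsub).trans ((measure_union_le _ _).trans (add_le_add le_rfl ?_))
    rw [ENNReal.ofReal_sum_of_nonneg hnonneg]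
    exact (measure_biUnion_finset_le _ _).trans
      (Finset.sum_le_sum fun π _ => volume_Icc_diff_Icc_le (h π) (hV π))
  have hfin := (volume_biUnion_Icc_lt_top S L).ne
  refine (ENNReal.toReal_mono (ENNReal.add_ne_top.2 ⟨hfin, ENNReal.ofReal_ne_top⟩) hle).trans_eq ?_
  rw [ENNReal.toReal_add hfin ENNReal.ofReal_ne_top,
    ENNReal.toReal_ofReal (Finset.sum_nonneg hnonneg), vol]

/-- **Theorem 2 (error bound for α-approximate pessimistic hypervolume maximization).**
If `Vh` estimates `V` with per-objective error at most `cf π i`, `L π i = Vh π i - cf π i`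
is the lower confidence bound (assumed to lie in `[0,1]`), `Sstar` is a size-`K` maximizer
of `vol · V`, and `Shat` is a size-`K` `α`-approximate maximizer of `vol · L`, then
`vol Shat V ≥ α * vol Sstar V - 2 * c Sstar` where `c S = ∑ π ∈ S, ∑ i, cf π i`. -/
theorem stmt_4 {P : Type*} [Fintype P] [Nonempty P] {m K : ℕ} (hm : 0 < m) (hK : 0 < K)
    (hKcard : K ≤ Fintype.card P)
    (V Vh : P → Fin m → ℝ) (cf : P → Fin m → ℝ)
    (hV : ∀ π i, V π i ∈ Set.Icc (0 : ℝ) 1)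
    (hc0 : ∀ π i, 0 ≤ cf π i)
    (hc : ∀ π i, |V π i - Vh π i| ≤ cf π i)
    (L : P → Fin m → ℝ) (hLdef : ∀ π i, L π i = Vh π i - cf π i)
    (hL : ∀ π i, L π i ∈ Set.Icc (0 : ℝ) 1)
    (Sstar : Finset P) (hSstarcard : Sstar.card = K)
    (hSstarmax : ∀ S : Finset P, S.card = K → vol S V ≤ vol Sstar V)
    (α : ℝ) (hα0 : 0 ≤ α) (hα1 : α ≤ 1)
    (Shat : Finset P) (hShatcard : Shat.card = K)
    (happrox : ∀ S : Finset P, S.card = K → α * vol S L ≤ vol Shat L) :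
    vol Shat V ≥ α * vol Sstar V - 2 * (∑ π ∈ Sstar, ∑ i, cf π i) := by
  have hLV : L ≤ V := fun π i => by
    linarith [hLdef π i, (abs_le.1 (hc π i)).1]
  have hgap : ∑ π ∈ Sstar, ∑ i, (V π i - L π i) ≤ 2 * ∑ π ∈ Sstar, ∑ i, cf π i := by
    simp only [Finset.mul_sum]
    refine Finset.sum_le_sum fun π _ => Finset.sum_le_sum fun i _ => ?_
    linarith [hLdef π i, (abs_le.1 (hc π i)).2]
  have hc_nonneg : 0 ≤ ∑ π ∈ Sstar, ∑ i, cf π i :=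
    Finset.sum_nonneg fun π _ => Finset.sum_nonneg fun i _ => hc0 π i
  have hstar : vol Sstar V ≤ vol Sstar L + 2 * ∑ π ∈ Sstar, ∑ i, cf π i :=
    (vol_le_vol_add_sum Sstar hLV fun π i => (hV π i).2).trans
      (add_le_add le_rfl hgap)
  have hmono := vol_mono Shat hLV
  have hhat := happrox Sstar hSstarcard
  nlinarith [mul_le_mul_of_nonneg_left hstar hα0, mul_nonneg (sub_nonneg.2 hα1) hc_nonneg]
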